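/- arXiv:2109.05079 — 2 statements merged into one kernel-verified Lean document; each statement's English description precedes it below -/
import Mathlib

section
/- Let q be a conservative Q-function satisfying Assumption L1. Then for all u ∈ [T₀,T₁), t ∈ (u,T₁), and x ∈ X, one has Σ_{n=0}^∞ P̄⁽ⁿ⁾(u,x;t,X) ≤ 1; in particular, P̄(u,x;t,·) := Σ_{n=0}^∞ P̄⁽ⁿ⁾(u,x;t,·) is a measure on (X,𝓑(X)) taking values in [0,1]. -/
open MeasureTheory Set Filter Topology
open scoped ENNReal

noncomputable section

/-- A conservative `Q`-function on the state space `X` with time horizon `[T₀, T₁)`,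
`T₁ ≤ +∞`.  It is encoded by the kernel `qp x t = q(x, t, · \ {x})`; since `q` is
conservative, the signed measure `q(x,t,·)` is recovered as
`q(x,t,B) = qp x t B - qp x t univ · 1{x ∈ B}`, so that `q(x,t,X) = 0`. -/
structure ConsQFun (X : Type*) [MeasurableSpace X] (T₀ : ℝ) (T₁ : EReal) where
  qp : X → ℝ → Measure X
  fin : ∀ x t, qp x t Set.univ ≠ ⊤
  diag : ∀ x t, qp x t {x} = 0
  meas : ∀ B : Set X, MeasurableSet B → Measurable fun p : X × ℝ => qp p.1 p.2 B

namespace ConsQFun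

variable {X : Type*} [MeasurableSpace X] {T₀ : ℝ} {T₁ : EReal}

/-- The jump rate `q(x,t) = q(x, t, X \ {x})`, as a real number. -/
def qrate (Q : ConsQFun X T₀ T₁) (x : X) (t : ℝ) : ℝ := (Q.qp x t Set.univ).toReal

/-- `q̄(x) = sup_{t ∈ [T₀,T₁)} q(x,t)`, computed in `ℝ≥0∞`. -/
def qbar (Q : ConsQFun X T₀ T₁) (x : X) : ℝ≥0∞ :=
  ⨆ t ∈ {t : ℝ | T₀ ≤ t ∧ (t : EReal) < T₁}, Q.qp x t Set.univ

/-- Assumption (Feller): there are Borel sets `Bₙ ↑ X` with `sup_{x ∈ Bₙ} q̄(x) < n`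
(for `n = 1, 2, …`; here reindexed by `n ↦ n + 1`). -/
def AssumptionFeller (Q : ConsQFun X T₀ T₁) : Prop :=
  ∃ B : ℕ → Set X, (∀ n, MeasurableSet (B n)) ∧ (∀ n, B n ⊆ B (n + 1)) ∧
    (⋃ n, B n) = Set.univ ∧ ∀ n : ℕ, (⨆ x ∈ B n, Q.qbar x) < (n : ℝ≥0∞) + 1

/-- Assumption (LB): `q̄(x) < ∞` for every `x`. -/
def AssumptionLB (Q : ConsQFun X T₀ T₁) : Prop := ∀ x, Q.qbar x < ⊤

/-- Assumption (ALB): `sup_{t ∈ [T₀,s)} q(x,t) < ∞` for every `x` and `s ∈ (T₀,T₁)`. -/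
def AssumptionALB (Q : ConsQFun X T₀ T₁) : Prop :=
  ∀ (x : X) (s : ℝ), T₀ < s → (s : EReal) < T₁ →
    (⨆ t ∈ Set.Ico T₀ s, Q.qp x t Set.univ) < ⊤

/-- Assumption (L1): `∫_{T₀}^s q(x,t) dt < ∞` for every `x` and `s ∈ (T₀,T₁)`. -/
def AssumptionL1 (Q : ConsQFun X T₀ T₁) : Prop :=
  ∀ (x : X) (s : ℝ), T₀ < s → (s : EReal) < T₁ →
    ∫⁻ t in Set.Ico T₀ s, Q.qp x t Set.univ < ⊤

/-- A set `B` is `(q,s)`-bounded if `q(x,t)` is bounded on `B × [T₀, s)`; for `s = T₁`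
this is the notion of a `q`-bounded set. -/
def QBddOn (Q : ConsQFun X T₀ T₁) (s : EReal) (B : Set X) : Prop :=
  ∃ C : ℝ≥0∞, C ≠ ⊤ ∧ ∀ x ∈ B, ∀ t : ℝ, T₀ ≤ t → (t : EReal) < s → Q.qp x t Set.univ ≤ C

/-- Feller's iterates: `P̄⁽⁰⁾(u,x;t,B) = 1{x∈B} e^{-∫_u^t q(x,s) ds}` and
`P̄⁽ⁿ⁾(u,x;t,B) = ∫_u^t ∫_X e^{-∫_u^w q(x,θ) dθ} P̄⁽ⁿ⁻¹⁾(w,y;t,B) q(x,w,dy∖{x}) dw`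
(the measure `q(x,w, ·∖{x})` is `Q.qp x w`, which has no atom at `x`). -/
def PbarN (Q : ConsQFun X T₀ T₁) : ℕ → ℝ → X → ℝ → Set X → ℝ≥0∞
  | 0 => fun u x t B =>
      B.indicator (fun _ => ENNReal.ofReal (Real.exp (-(∫ s in u..t, Q.qrate x s)))) x
  | n + 1 => fun u x t B =>
      ∫⁻ w in Set.Ioo u t,
        ∫⁻ y, ENNReal.ofReal (Real.exp (-(∫ θ in u..w, Q.qrate x θ))) * Q.PbarN n w y t B
          ∂(Q.qp x w)

/-- The transition function `P̄(u,x;t,B) = Σ_{n=0}^∞ P̄⁽ⁿ⁾(u,x;t,B)`. -/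
def Pbar (Q : ConsQFun X T₀ T₁) (u : ℝ) (x : X) (t : ℝ) (B : Set X) : ℝ≥0∞ :=
  ∑' n, Q.PbarN n u x t B

/-- `P̄` as a real-valued function. -/
def PbarR (Q : ConsQFun X T₀ T₁) (u : ℝ) (x : X) (t : ℝ) (B : Set X) : ℝ :=
  (Q.Pbar u x t B).toReal

end ConsQFun

/-- A real-valued function `f` is absolutely continuous on a set `s ⊆ ℝ`: for every `ε > 0`
there is `δ > 0` such that for every finite collection of nonoverlapping intervals
`(aᵢ, bᵢ)` with endpoints in `s` and total length `< δ`, `Σ |f(bᵢ) - f(aᵢ)| < ε`. -/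
def AbsContinuousOn (f : ℝ → ℝ) (s : Set ℝ) : Prop :=
  ∀ ε > (0 : ℝ), ∃ δ > (0 : ℝ), ∀ (n : ℕ) (a b : ℕ → ℝ),
    (∀ i, i < n → a i ∈ s ∧ b i ∈ s ∧ a i ≤ b i) →
    (∀ i, i < n → ∀ j, j < n → i ≠ j → Disjoint (Set.Ioo (a i) (b i)) (Set.Ioo (a j) (b j))) →
    (∑ i ∈ Finset.range n, (b i - a i)) < δ →
    (∑ i ∈ Finset.range n, |f (b i) - f (a i)|) < ε

namespace ConsQFun

variable {X : Type*} [MeasurableSpace X] {T₀ : ℝ} {T₁ : EReal}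

lemma meas_congr {α β : Type*} [MeasurableSpace α] [MeasurableSpace β] {f g : α → β}
    (hf : Measurable f) (h : f = g) : Measurable g := h ▸ hf

lemma measurable_qrate (Q : ConsQFun X T₀ T₁) :
    Measurable fun p : X × ℝ => Q.qrate p.1 p.2 :=
  (Q.meas _ MeasurableSet.univ).ennreal_toReal

lemma measurable_intq (Q : ConsQFun X T₀ T₁) :
    Measurable fun p : (ℝ × ℝ) × X => ∫ s in p.1.1..p.1.2, Q.qrate p.2 s := by
  have key : ∀ (f g : (ℝ × ℝ) × X → ℝ), Measurable f → Measurable g →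
      Measurable fun p : (ℝ × ℝ) × X => ∫ s in Ioc (f p) (g p), Q.qrate p.2 s := by
    intro f g hf hg
    have hset : MeasurableSet {z : ((ℝ × ℝ) × X) × ℝ | f z.1 < z.2 ∧ z.2 ≤ g z.1} :=
      (measurableSet_lt (hf.comp measurable_fst) measurable_snd).inter
        (measurableSet_le measurable_snd (hg.comp measurable_fst))
    have hq : Measurable fun z : ((ℝ × ℝ) × X) × ℝ => Q.qrate z.1.2 z.2 :=
      Q.measurable_qrate.comp (measurable_fst.snd.prodMk measurable_snd)
    have h := (hq.indicator hset).stronglyMeasurable.integral_prod_right' (ν := volume)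
    refine meas_congr h.measurable ?_
    funext p
    rw [← integral_indicator measurableSet_Ioc]
    rfl
  simp only [intervalIntegral]
  exact (key _ _ measurable_fst.fst measurable_fst.snd).sub
    (key _ _ measurable_fst.snd measurable_fst.fst)

lemma measurable_lint (Q : ConsQFun X T₀ T₁) {f : ℝ × X → ℝ≥0∞} (hf : Measurable f) :
    Measurable fun p : X × ℝ => ∫⁻ y, f (p.2, y) ∂(Q.qp p.1 p.2) := by
  have hm := Q.meas _ MeasurableSet.univ
  let κ : ProbabilityTheory.Kernel (X × ℝ) X :=
    { toFun := fun p => (Q.qp p.1 p.2 univ)⁻¹ • Q.qp p.1 p.2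
      measurable' := by
        refine Measure.measurable_of_measurable_coe _ fun s hs => ?_
        simp only [Measure.smul_apply, smul_eq_mul]
        exact hm.inv.mul (Q.meas s hs) }
  have hκ : ∀ p, κ p = (Q.qp p.1 p.2 univ)⁻¹ • Q.qp p.1 p.2 := fun p => rfl
  have : ProbabilityTheory.IsFiniteKernel κ := by
    refine ⟨1, ENNReal.one_lt_top, fun p => ?_⟩
    rw [hκ, Measure.smul_apply, smul_eq_mul]
    exact ENNReal.inv_mul_le_one _
  have h1 : Measurable fun p : X × ℝ => ∫⁻ y, f (p.2, y) ∂(κ p) := by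
    refine Measurable.lintegral_kernel_prod_right' (κ := κ)
      (f := fun z : (X × ℝ) × X => f (z.1.2, z.2)) ?_
    exact hf.comp (measurable_fst.snd.prodMk measurable_snd)
  refine meas_congr (hm.mul h1) ?_
  funext p
  simp only [Pi.mul_apply]
  rw [hκ, lintegral_smul_measure, smul_eq_mul, ← mul_assoc]
  by_cases h0 : Q.qp p.1 p.2 univ = 0
  · rw [Measure.measure_univ_eq_zero.1 h0]; simp
  · rw [ENNReal.mul_inv_cancel h0 (Q.fin _ _), one_mul]

lemma measurable_E (Q : ConsQFun X T₀ T₁) :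
    Measurable fun p : (ℝ × ℝ) × X =>
      ENNReal.ofReal (Real.exp (-(∫ s in p.1.1..p.1.2, Q.qrate p.2 s))) :=
  (Real.measurable_exp.comp Q.measurable_intq.neg).ennreal_ofReal

lemma PbarN_succ (Q : ConsQFun X T₀ T₁) (n : ℕ) (u : ℝ) (x : X) (t : ℝ) (B : Set X) :
    Q.PbarN (n + 1) u x t B = ∫⁻ w in Set.Ioo u t,
        ∫⁻ y, ENNReal.ofReal (Real.exp (-(∫ θ in u..w, Q.qrate x θ))) * Q.PbarN n w y t B
          ∂(Q.qp x w) := rfl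

lemma PbarN_zero (Q : ConsQFun X T₀ T₁) (u : ℝ) (x : X) (t : ℝ) (B : Set X) :
    Q.PbarN 0 u x t B =
      B.indicator (fun _ => ENNReal.ofReal (Real.exp (-(∫ s in u..t, Q.qrate x s)))) x := rfl

lemma measurable_step (Q : ConsQFun X T₀ T₁) (t : ℝ) {f : ℝ × X → ℝ≥0∞} (hf : Measurable f) :
    Measurable fun p : ℝ × X => ∫⁻ w in Set.Ioo p.1 t,
        ∫⁻ y, ENNReal.ofReal (Real.exp (-(∫ θ in p.1..w, Q.qrate p.2 θ))) * f (w, y)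
          ∂(Q.qp p.2 w) := by
  have hset : MeasurableSet {z : (ℝ × X) × ℝ | z.1.1 < z.2 ∧ z.2 < t} :=
    (measurableSet_lt measurable_fst.fst measurable_snd).inter
      (measurableSet_lt measurable_snd measurable_const)
  have h1 : Measurable fun z : (ℝ × X) × ℝ =>
      ENNReal.ofReal (Real.exp (-(∫ θ in z.1.1..z.2, Q.qrate z.1.2 θ))) *
        ∫⁻ y, f (z.2, y) ∂(Q.qp z.1.2 z.2) :=
    (Q.measurable_E.comp ((measurable_fst.fst.prodMk measurable_snd).prodMk
      measurable_fst.snd)).mul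
      ((Q.measurable_lint hf).comp (measurable_fst.snd.prodMk measurable_snd))
  refine meas_congr ((h1.indicator hset).lintegral_prod_right' (ν := volume)) ?_
  funext p
  rw [← lintegral_indicator measurableSet_Ioo]
  refine lintegral_congr fun w => ?_
  simp only [indicator, mem_ofPred_eq, mem_Ioo]
  split_ifs
  · exact (lintegral_const_mul _ (hf.comp measurable_prodMk_left)).symm
  · rfl

lemma measurable_PbarN (Q : ConsQFun X T₀ T₁) (t : ℝ) {B : Set X} (hB : MeasurableSet B)
    (n : ℕ) : Measurable fun p : ℝ × X => Q.PbarN n p.1 p.2 t B := by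
  induction n with
  | zero =>
    have h0 : Measurable fun p : ℝ × X => (((p.1, t), p.2) : (ℝ × ℝ) × X) := by fun_prop
    have h1 : Measurable fun p : ℝ × X =>
        ENNReal.ofReal (Real.exp (-(∫ s in p.1..t, Q.qrate p.2 s))) := by
      have h2 := Q.measurable_E.comp h0
      simp only [Function.comp_def] at h2
      exact h2
    have hs : MeasurableSet {p : ℝ × X | p.2 ∈ B} := measurable_snd hB
    refine meas_congr (h1.indicator hs) ?_
    funext p
    simp only [PbarN_zero, indicator, mem_ofPred_eq]
  | succ n ih =>
    refine meas_congr (Q.measurable_step t ih) ?_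
    funext p
    simp only [PbarN_succ]

lemma measurable_PbarN_snd (Q : ConsQFun X T₀ T₁) (t : ℝ) {B : Set X} (hB : MeasurableSet B)
    (n : ℕ) (w : ℝ) : Measurable fun y : X => Q.PbarN n w y t B :=
  (Q.measurable_PbarN t hB n).comp measurable_prodMk_left

lemma measurable_inner (Q : ConsQFun X T₀ T₁) (u : ℝ) (x : X) {f : ℝ × X → ℝ≥0∞}
    (hf : Measurable f) :
    Measurable fun w : ℝ =>
        ∫⁻ y, ENNReal.ofReal (Real.exp (-(∫ θ in u..w, Q.qrate x θ))) * f (w, y)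
          ∂(Q.qp x w) := by
  have h1 : Measurable fun w : ℝ =>
      ENNReal.ofReal (Real.exp (-(∫ θ in u..w, Q.qrate x θ))) * ∫⁻ y, f (w, y) ∂(Q.qp x w) :=
    (Q.measurable_E.comp ((measurable_const.prodMk measurable_id).prodMk measurable_const)).mul
      ((Q.measurable_lint hf).comp (measurable_const.prodMk measurable_id))
  refine meas_congr h1 ?_
  funext w
  exact (lintegral_const_mul _ (hf.comp measurable_prodMk_left)).symm

lemma PbarN_empty (Q : ConsQFun X T₀ T₁) (t : ℝ) (n : ℕ) :
    ∀ (u : ℝ) (x : X), Q.PbarN n u x t ∅ = 0 := by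
  induction n with
  | zero => intro u x; simp [PbarN_zero]
  | succ n ih => intro u x; simp [PbarN_succ, ih]

lemma PbarN_iUnion (Q : ConsQFun X T₀ T₁) (t : ℝ) {f : ℕ → Set X}
    (hf : ∀ i, MeasurableSet (f i)) (hd : Pairwise (Function.onFun Disjoint f)) (n : ℕ) :
    ∀ (u : ℝ) (x : X), Q.PbarN n u x t (⋃ i, f i) = ∑' i, Q.PbarN n u x t (f i) := by
  induction n with
  | zero =>
    intro u x
    simp only [PbarN_zero]
    by_cases hx : x ∈ ⋃ i, f i
    · obtain ⟨i, hi⟩ := mem_iUnion.1 hx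
      rw [indicator_of_mem hx, tsum_eq_single i, indicator_of_mem hi]
      intro j hj
      exact indicator_of_notMem (fun hxj => (Set.disjoint_left.1 (hd hj)) hxj hi) _
    · rw [indicator_of_notMem hx]
      have : ∀ i, x ∉ f i := fun i hi => hx (mem_iUnion.2 ⟨i, hi⟩)
      simp [this]
  | succ n ih =>
    intro u x
    simp only [PbarN_succ, ih, ← ENNReal.tsum_mul_left]
    rw [← lintegral_tsum fun i =>
      (Q.measurable_inner u x (Q.measurable_PbarN t (hf i) n)).aemeasurable]
    refine lintegral_congr fun w => ?_
    rw [lintegral_tsum fun i =>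
      ((Q.measurable_PbarN_snd t (hf i) n w).const_mul _).aemeasurable]

lemma exp_bound {q : ℝ → ℝ} {u t : ℝ} (hut : u ≤ t) (hq0 : ∀ s, 0 ≤ q s)
    (hq : IntervalIntegrable q volume u t) :
    ENNReal.ofReal (Real.exp (-(∫ s in u..t, q s))) +
      ∫⁻ w in Ioo u t, ENNReal.ofReal (Real.exp (-(∫ s in u..w, q s))) * ENNReal.ofReal (q w)
      ≤ 1 := by
  set g : ℝ → ℝ := fun w => 1 - Real.exp (-(∫ s in u..w, q s)) with hg
  have hmono : MonotoneOn g (uIcc u t) := by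
    rw [uIcc_of_le hut]
    intro a ha b hb hab
    have hi : IntervalIntegrable q volume u b :=
      hq.mono_set (by rw [uIcc_of_le hut, uIcc_of_le hb.1]; exact Icc_subset_Icc_right hb.2)
    have : ∫ s in u..a, q s ≤ ∫ s in u..b, q s :=
      intervalIntegral.integral_mono_interval le_rfl ha.1 hab
        (Eventually.of_forall hq0) hi
    simp only [hg]
    gcongr
  have hint := hmono.intervalIntegrable_deriv
  have hle := hmono.intervalIntegral_deriv_mem_uIcc
  have hgt : 0 ≤ g t - g u := sub_nonneg.2 (hmono left_mem_uIcc right_mem_uIcc hut)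
  rw [uIcc_of_le hgt] at hle
  have hgu : g u = 0 := by simp [hg]
  rw [hgu, sub_zero] at hle
  have hae : ∀ᵐ w, w ∈ Ioc u t → deriv g w = Real.exp (-(∫ s in u..w, q s)) * q w := by
    filter_upwards [hq.ae_hasDerivAt_integral] with w hw hwm
    have h := hw (by rw [uIcc_of_le hut]; exact Ioc_subset_Icc_self hwm) u left_mem_uIcc
    have h2 := (h.neg.exp.const_sub 1).deriv
    simp only [hg]
    refine Eq.trans h2 ?_
    simp only [Pi.neg_apply]
    ring
  have hae' := (ae_restrict_iff' measurableSet_Ioc).2 hae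
  have hInt : IntegrableOn (deriv g) (Ioc u t) := (intervalIntegrable_iff_integrableOn_Ioc_of_le hut).1 hint
  have e1 : ∫⁻ w in Ioc u t,
      ENNReal.ofReal (Real.exp (-(∫ s in u..w, q s))) * ENNReal.ofReal (q w)
      = ENNReal.ofReal (∫ w in u..t, deriv g w) := by
    rw [intervalIntegral.integral_of_le hut, ofReal_integral_eq_lintegral_ofReal hInt]
    · refine lintegral_congr_ae ?_
      filter_upwards [hae'] with w hw
      rw [hw, ENNReal.ofReal_mul (Real.exp_pos _).le]
    · filter_upwards [hae'] with w hw
      rw [hw]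
      exact mul_nonneg (Real.exp_pos _).le (hq0 w)
  have e2 := (lintegral_mono_set (μ := volume) (f := fun w =>
    ENNReal.ofReal (Real.exp (-(∫ s in u..w, q s))) * ENNReal.ofReal (q w))
    (show Ioo u t ⊆ Ioc u t from Ioo_subset_Ioc_self)).trans_eq e1
  refine (add_le_add_right (e2.trans (ENNReal.ofReal_le_ofReal hle.2)) _).trans ?_
  rw [← ENNReal.ofReal_add (Real.exp_pos _).le (hle.1.trans hle.2)]
  simp [hg]

lemma intervalIntegrable_qrate (Q : ConsQFun X T₀ T₁) (hL1 : Q.AssumptionL1)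
    {u t : ℝ} (x : X) (hu : T₀ ≤ u) (hut : u < t) (ht : (t : EReal) < T₁) :
    IntervalIntegrable (Q.qrate x) volume u t := by
  rw [intervalIntegrable_iff_integrableOn_Ico_of_le hut.le]
  have h := hL1 x t (hu.trans_lt hut) ht
  have h2 : IntegrableOn (Q.qrate x) (Ico T₀ t) :=
    integrable_toReal_of_lintegral_ne_top
      ((Q.meas _ MeasurableSet.univ).comp measurable_prodMk_left).aemeasurable h.ne
  exact h2.mono_set (Ico_subset_Ico_left hu)

lemma sum_le_one (Q : ConsQFun X T₀ T₁) (hL1 : Q.AssumptionL1) {t : ℝ}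
    (ht : (t : EReal) < T₁) (N : ℕ) :
    ∀ (u : ℝ) (x : X), T₀ ≤ u → u < t →
      ∑ n ∈ Finset.range N, Q.PbarN n u x t univ ≤ 1 := by
  induction N with
  | zero => intro u x _ _; simp
  | succ N ih =>
    intro u x hu hut
    rw [Finset.sum_range_succ', add_comm]
    refine le_trans ?_ (exp_bound hut.le (q := Q.qrate x) (fun s => ENNReal.toReal_nonneg)
      (Q.intervalIntegrable_qrate hL1 x hu hut ht))
    simp only [PbarN_zero, indicator_univ, PbarN_succ]
    gcongr
    rw [← lintegral_finsetSum _ fun n _ =>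
      Q.measurable_inner u x (Q.measurable_PbarN t MeasurableSet.univ n)]
    refine setLIntegral_mono' measurableSet_Ioo fun w hw => ?_
    dsimp only
    rw [← lintegral_finsetSum _ fun n _ =>
      (Q.measurable_PbarN_snd t MeasurableSet.univ n w).const_mul _]
    calc _ ≤ ∫⁻ _, ENNReal.ofReal (Real.exp (-(∫ θ in u..w, Q.qrate x θ))) ∂(Q.qp x w) := by
          refine lintegral_mono fun y => ?_
          rw [← Finset.mul_sum]
          exact mul_le_of_le_one_right' (ih w y (hu.trans hw.1.le) hw.2)
      _ = _ := by
          rw [lintegral_const, qrate, ENNReal.ofReal_toReal (Q.fin _ _)]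

end ConsQFun

/-- under Assumption L1, `Σ_{n=0}^∞ P̄⁽ⁿ⁾(u,x;t,X) ≤ 1`; in particular,
`P̄(u,x;t,·)` is a measure on `(X, 𝓑(X))` with values in `[0,1]`. -/
theorem pbar_le_one_and_isMeasure
    {X : Type*} [MeasurableSpace X] [StandardBorelSpace X]
    {T₀ : ℝ} {T₁ : EReal} (hT : (T₀ : EReal) < T₁)
    (Q : ConsQFun X T₀ T₁) (hL1 : Q.AssumptionL1)
    (u t : ℝ) (x : X) (hu : T₀ ≤ u) (hut : u < t) (ht : (t : EReal) < T₁) :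
    Q.Pbar u x t Set.univ ≤ 1 ∧
      ∃ μ : Measure X, ∀ B : Set X, MeasurableSet B → μ B = Q.Pbar u x t B := by
  refine ⟨?_, ?_⟩
  · rw [ConsQFun.Pbar, ENNReal.tsum_eq_iSup_nat]
    exact iSup_le fun N => Q.sum_le_one hL1 ht N u x hu hut
  · refine ⟨Measure.ofMeasurable (fun B _ => Q.Pbar u x t B) ?_ ?_, ?_⟩
    · simp [ConsQFun.Pbar, ConsQFun.PbarN_empty]
    · intro f hf hd
      simp only [ConsQFun.Pbar, Q.PbarN_iUnion t hf hd]
      exact ENNReal.tsum_comm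
    · intro B hB
      exact Measure.ofMeasurable_apply B hB
end
end

section
/- Let q be a conservative Q-function satisfying Assumption ALB. Then for all u ∈ [T₀,T₁), s ∈ (u,T₁), x ∈ X, and every (q,s)-bounded set B ∈ 𝓑(X): lim_{t→u+} P̄(u,x;t,B) = 1{x∈B}, the function t ↦ P̄(u,x;t,B) is absolutely continuous on (u,s), and Kolmogorov's forward equation (∂/∂t)P̄(u,x;t,B) = −∫_B q(y,t) P̄(u,x;t,dy) + ∫_X q(y,t,B∖{y}) P̄(u,x;t,dy) holds for almost every t ∈ (u,s). -/
open MeasureTheory Set Filter Topology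
open scoped ENNReal

noncomputable section

namespace ConsQFun

variable {X : Type*} [MeasurableSpace X] {T₀ : ℝ} {T₁ : EReal}

/-- The jump kernel. -/
def kern (Q : ConsQFun X T₀ T₁) : ProbabilityTheory.Kernel (X × ℝ) X where
  toFun p := Q.qp p.1 p.2
  measurable' := Measure.measurable_of_measurable_coe _ Q.meas

instance (Q : ConsQFun X T₀ T₁) (x : X) (t : ℝ) : IsFiniteMeasure (Q.qp x t) :=
  ⟨lt_top_iff_ne_top.2 (Q.fin x t)⟩

lemma kern_apply (Q : ConsQFun X T₀ T₁) (p : X × ℝ) : Q.kern p = Q.qp p.1 p.2 := rfl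

instance (Q : ConsQFun X T₀ T₁) : ProbabilityTheory.IsSFiniteKernel Q.kern := by
  classical
  have hs : ∀ n : ℕ, MeasurableSet {p : X × ℝ | ⌊Q.qrate p.1 p.2⌋₊ = n} := fun n =>
    (Nat.measurable_floor.comp Q.measurable_qrate) (measurableSet_singleton n)
  refine ⟨fun n => ProbabilityTheory.Kernel.piecewise (hs n) Q.kern 0, fun n => ?_, ?_⟩
  · refine ⟨⟨(n : ℝ≥0∞) + 1, by finiteness, fun p => ?_⟩⟩
    rw [ProbabilityTheory.Kernel.piecewise_apply']
    split_ifs with h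
    · have h1 : Q.qrate p.1 p.2 < n + 1 := by
        have := Nat.lt_floor_add_one (Q.qrate p.1 p.2)
        rwa [show ⌊Q.qrate p.1 p.2⌋₊ = n from h] at this
      rw [kern_apply, ← ENNReal.ofReal_toReal (Q.fin p.1 p.2)]
      calc _ ≤ ENNReal.ofReal ((n : ℝ) + 1) := ENNReal.ofReal_le_ofReal h1.le
        _ = _ := by
          rw [ENNReal.ofReal_add (by positivity) (by positivity)]; simp
    · simp
  · ext p B hB
    rw [ProbabilityTheory.Kernel.sum_apply' _ _ hB]
    rw [tsum_eq_single ⌊Q.qrate p.1 p.2⌋₊]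
    · rw [ProbabilityTheory.Kernel.piecewise_apply', if_pos (by simp)]
    · intro n hn
      rw [ProbabilityTheory.Kernel.piecewise_apply', if_neg (by simpa using hn.symm)]
      simp

/-- survival factor -/
def E (Q : ConsQFun X T₀ T₁) (u : ℝ) (x : X) (t : ℝ) : ℝ≥0∞ :=
  ENNReal.ofReal (Real.exp (-(∫ s in u..t, Q.qrate x s)))

lemma measurable_E_s8 (Q : ConsQFun X T₀ T₁) :
    Measurable fun p : ℝ × X × ℝ => Q.E p.1 p.2.1 p.2.2 := by
  have key : ∀ (a b : ℝ × X × ℝ → ℝ), Measurable a → Measurable b →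
      Measurable fun p : ℝ × X × ℝ => ∫ s in Ioc (a p) (b p), Q.qrate p.2.1 s := by
    intro a b ha hb
    have : (fun p : ℝ × X × ℝ => ∫ s in Ioc (a p) (b p), Q.qrate p.2.1 s)
        = fun p => ∫ s, {r : (ℝ × X × ℝ) × ℝ | a r.1 < r.2 ∧ r.2 ≤ b r.1}.indicator
          (fun r => Q.qrate r.1.2.1 r.2) (p, s) := by
      funext p
      rw [← integral_indicator measurableSet_Ioc]
      rfl
    rw [this]
    refine (StronglyMeasurable.integral_prod_right' ?_).measurable
    refine (Measurable.indicator ?_ ?_).stronglyMeasurable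
    · exact Q.measurable_qrate.comp (by fun_prop : Measurable fun r : (ℝ × X × ℝ) × ℝ => (r.1.2.1, r.2))
    · exact (measurableSet_lt (ha.comp measurable_fst) measurable_snd).inter
        (measurableSet_le measurable_snd (hb.comp measurable_fst))
  unfold E intervalIntegral
  have h1 := key (fun p => p.1) (fun p => p.2.2) (by fun_prop) (by fun_prop)
  have h2 := key (fun p => p.2.2) (fun p => p.1) (by fun_prop) (by fun_prop)
  exact ((h1.sub h2).neg.exp).ennreal_ofReal

/-- Feller's iterates acting on time-dependent functions. -/
def F (Q : ConsQFun X T₀ T₁) : ℕ → ℝ → X → ℝ → (ℝ → X → ℝ≥0∞) → ℝ≥0∞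
  | 0 => fun u x t f => Q.E u x t * f t x
  | n + 1 => fun u x t f =>
      ∫⁻ w in Set.Ioo u t, ∫⁻ y, Q.E u x w * Q.F n w y t f ∂(Q.qp x w)

lemma PbarN_eq_F (Q : ConsQFun X T₀ T₁) (n : ℕ) (u : ℝ) (x : X) (t : ℝ) (B : Set X) :
    Q.PbarN n u x t B = Q.F n u x t (fun _ => B.indicator 1) := by
  induction n generalizing u x with
  | zero => by_cases h : x ∈ B <;> simp [PbarN, F, E, h]
  | succ n ih => simp only [PbarN, F, E, ih]

lemma measurable_Fstep (Q : ConsQFun X T₀ T₁) {g : ℝ × X × ℝ → ℝ≥0∞} (hg : Measurable g) :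
    Measurable fun p : (ℝ × X × ℝ) × ℝ =>
      ∫⁻ y, Q.E p.1.1 p.1.2.1 p.2 * g (p.2, y, p.1.2.2) ∂(Q.qp p.1.2.1 p.2) := by
  have hk := Measurable.lintegral_kernel_prod_right'
    (κ := Q.kern.comap (fun p : (ℝ × X × ℝ) × ℝ => (p.1.2.1, p.2)) (by fun_prop))
    (f := fun q : ((ℝ × X × ℝ) × ℝ) × X =>
      Q.E q.1.1.1 q.1.1.2.1 q.1.2 * g (q.1.2, q.2, q.1.1.2.2)) ?_
  · exact hk
  · refine Measurable.mul ?_ (hg.comp (by fun_prop))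
    exact Q.measurable_E_s8.comp (by fun_prop :
      Measurable fun q : ((ℝ × X × ℝ) × ℝ) × X => (q.1.1.1, q.1.1.2.1, q.1.2))

lemma measurable_lintegral_Ioo {α : Type*} [MeasurableSpace α] {a b : α → ℝ} (ha : Measurable a)
    (hb : Measurable b) {g : α × ℝ → ℝ≥0∞} (hg : Measurable g) :
    Measurable fun p => ∫⁻ w in Ioo (a p) (b p), g (p, w) := by
  have : (fun p => ∫⁻ w in Ioo (a p) (b p), g (p, w))
      = fun p => ∫⁻ w, {r : α × ℝ | a r.1 < r.2 ∧ r.2 < b r.1}.indicator g (p, w) := by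
    funext p
    rw [← lintegral_indicator measurableSet_Ioo]
    rfl
  rw [this]
  refine Measurable.lintegral_prod_right' (hg.indicator ?_)
  exact (measurableSet_lt (ha.comp measurable_fst) measurable_snd).inter
        (measurableSet_lt measurable_snd (hb.comp measurable_fst))

lemma measurable_F (Q : ConsQFun X T₀ T₁) {f : ℝ → X → ℝ≥0∞}
    (hf : Measurable fun p : ℝ × X => f p.1 p.2) (n : ℕ) :
    Measurable fun p : ℝ × X × ℝ => Q.F n p.1 p.2.1 p.2.2 f := by
  induction n with
  | zero =>
    exact Q.measurable_E_s8.mul (hf.comp (by fun_prop : Measurable fun p : ℝ × X × ℝ => (p.2.2, p.2.1)))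
  | succ n ih =>
    exact measurable_lintegral_Ioo measurable_fst (by fun_prop) (Q.measurable_Fstep ih)

lemma measurable_F_y (Q : ConsQFun X T₀ T₁) {f : ℝ → X → ℝ≥0∞}
    (hf : Measurable fun p : ℝ × X => f p.1 p.2) (n : ℕ) (u t : ℝ) :
    Measurable fun y : X => Q.F n u y t f :=
  (Q.measurable_F hf n).comp (by fun_prop : Measurable fun y : X => (u, y, t))

lemma measurable_F_t (Q : ConsQFun X T₀ T₁) {f : ℝ → X → ℝ≥0∞}
    (hf : Measurable fun p : ℝ × X => f p.1 p.2) (n : ℕ) (u : ℝ) (x : X) :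
    Measurable fun t : ℝ => Q.F n u x t f :=
  (Q.measurable_F hf n).comp (by fun_prop : Measurable fun t : ℝ => (u, x, t))

lemma measurable_Fint (Q : ConsQFun X T₀ T₁) {f : ℝ → X → ℝ≥0∞}
    (hf : Measurable fun p : ℝ × X => f p.1 p.2) (n : ℕ) (u : ℝ) (x : X) (t : ℝ) :
    Measurable fun w : ℝ => ∫⁻ y, Q.E u x w * Q.F n w y t f ∂(Q.qp x w) :=
  (Q.measurable_Fstep (Q.measurable_F hf n)).comp
    (by fun_prop : Measurable fun w : ℝ => ((u, x, t), w))

lemma F_add (Q : ConsQFun X T₀ T₁) {f g : ℝ → X → ℝ≥0∞}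
    (hf : Measurable fun p : ℝ × X => f p.1 p.2)
    (n : ℕ) (u : ℝ) (x : X) (t : ℝ) :
    Q.F n u x t (f + g) = Q.F n u x t f + Q.F n u x t g := by
  induction n generalizing u x with
  | zero => simp [F, mul_add]
  | succ n ih =>
    simp only [F, ih, mul_add]
    rw [← lintegral_add_left (Q.measurable_Fint hf n u x t)]
    congr with w
    rw [lintegral_add_left ((Q.measurable_F_y hf n w t).const_mul _)]

lemma F_smul (Q : ConsQFun X T₀ T₁) {f : ℝ → X → ℝ≥0∞}
    (hf : Measurable fun p : ℝ × X => f p.1 p.2) (c : ℝ≥0∞)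
    (n : ℕ) (u : ℝ) (x : X) (t : ℝ) :
    Q.F n u x t (fun t y => c * f t y) = c * Q.F n u x t f := by
  induction n generalizing u x with
  | zero => simp only [F]; ring
  | succ n ih =>
    simp only [F, ih]
    rw [← lintegral_const_mul c (Q.measurable_Fint hf n u x t)]
    congr with w
    rw [← lintegral_const_mul c ((Q.measurable_F_y hf n w t).const_mul _)]
    congr with y
    ring

lemma F_mono (Q : ConsQFun X T₀ T₁) {f g : ℝ → X → ℝ≥0∞}
    (n : ℕ) (u : ℝ) (x : X) (t : ℝ) (hfg : ∀ y, f t y ≤ g t y) :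
    Q.F n u x t f ≤ Q.F n u x t g := by
  induction n generalizing u x with
  | zero => simp only [F]; gcongr; exact hfg x
  | succ n ih =>
    simp only [F]
    gcongr
    exact ih _ _

lemma F_iSup (Q : ConsQFun X T₀ T₁) {f : ℕ → ℝ → X → ℝ≥0∞}
    (hf : ∀ k, Measurable fun p : ℝ × X => f k p.1 p.2) (hm : Monotone f)
    (n : ℕ) (u : ℝ) (x : X) (t : ℝ) :
    Q.F n u x t (fun t y => ⨆ k, f k t y) = ⨆ k, Q.F n u x t (f k) := by
  induction n generalizing u x with
  | zero => simp only [F]; rw [ENNReal.mul_iSup]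
  | succ n ih =>
    simp only [F, ih]
    have hmono : ∀ u x, Monotone fun k => Q.F n u x t (f k) := fun u x i j hij =>
      Q.F_mono n u x t (fun y => hm hij t y)
    rw [← lintegral_iSup (fun k => Q.measurable_Fint (hf k) n u x t)]
    · congr with w
      rw [← lintegral_iSup (fun k => (Q.measurable_F_y (hf k) n w t).const_mul _)]
      · congr with y
        rw [ENNReal.mul_iSup]
      · intro i j hij y
        exact mul_le_mul_right (hmono w y hij) _
    · intro i j hij w
      exact lintegral_mono fun y => mul_le_mul_right (hmono w y hij) _

/-- integration against a measure agreeing with Pbar -/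
lemma lintegral_of_agree (Q : ConsQFun X T₀ T₁) (u : ℝ) (x : X) (t : ℝ) (ν : Measure X)
    (hν : ∀ C : Set X, MeasurableSet C → ν C = Q.Pbar u x t C)
    {f : X → ℝ≥0∞} (hf : Measurable f) :
    ∫⁻ y, f y ∂ν = ∑' n, Q.F n u x t (fun _ => f) := by
  refine Measurable.ennreal_induction
    (motive := fun f => ∫⁻ y, f y ∂ν = ∑' n, Q.F n u x t (fun _ => f)) ?_ ?_ ?_ hf
  · intro c C hC
    rw [lintegral_indicator_const hC, hν C hC, Pbar, ← ENNReal.tsum_mul_left]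
    congr with n
    rw [PbarN_eq_F, ← F_smul]
    · congr 1
      funext t y
      by_cases h : y ∈ C <;> simp [h]
    · exact (measurable_one.indicator hC).comp measurable_snd
  · intro f g _ hf hg h1 h2
    simp only [Pi.add_apply]
    rw [lintegral_add_left hf, h1, h2, ← ENNReal.tsum_add]
    congr with n
    rw [← F_add _ (hf.comp measurable_snd)]
    rfl
  · intro f hf hm h
    rw [lintegral_iSup hf hm]
    simp only [h]
    rw [show (fun n => Q.F n u x t fun _ x => ⨆ n, f n x) =
      fun n => ⨆ k, Q.F n u x t (fun _ => f k) from funext fun n =>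
        Q.F_iSup (f := fun k _ => f k) (fun k => (hf k).comp measurable_snd)
          (fun i j hij _ => hm hij) n u x t]
    rw [ENNReal.tsum_eq_iSup_sum]
    simp only [ENNReal.tsum_eq_iSup_sum]
    rw [iSup_comm]
    congr with s
    rw [ENNReal.finsetSum_iSup_of_monotone]
    intro n i j hij
    exact Q.F_mono n u x t (fun y => hm hij y)

lemma swap (Q : ConsQFun X T₀ T₁) {f : ℝ → X → ℝ≥0∞}
    (hf : Measurable fun p : ℝ × X => f p.1 p.2) (n : ℕ) (u : ℝ) (x : X) (t : ℝ) :
    ∫⁻ w in Ioo u t, Q.F (n + 1) u x w f =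
      ∫⁻ v in Ioo u t, ∫⁻ y, Q.E u x v * (∫⁻ w in Ioo v t, Q.F n v y w f) ∂(Q.qp x v) := by
  set S : Set (ℝ × ℝ) := {p | u < p.2 ∧ p.2 < p.1 ∧ p.1 < t} with hS
  have hSm : MeasurableSet S :=
    (measurableSet_lt measurable_const measurable_snd).inter
      ((measurableSet_lt measurable_snd measurable_fst).inter
        (measurableSet_lt measurable_fst measurable_const))
  set g : ℝ × ℝ → ℝ≥0∞ := fun p => ∫⁻ y, Q.E u x p.2 * Q.F n p.2 y p.1 f ∂(Q.qp x p.2) with hg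
  have hgm : Measurable g :=
    (Q.measurable_Fstep (Q.measurable_F hf n)).comp
      (by fun_prop : Measurable fun p : ℝ × ℝ => ((u, x, p.1), p.2))
  have h1 : ∫⁻ w in Ioo u t, Q.F (n + 1) u x w f = ∫⁻ w, ∫⁻ v, S.indicator g (w, v) := by
    rw [← lintegral_indicator measurableSet_Ioo]
    congr with w
    by_cases hw : w ∈ Ioo u t
    · rw [indicator_of_mem hw]
      simp only [F]
      rw [← lintegral_indicator measurableSet_Ioo]
      congr with v
      by_cases hv : v ∈ Ioo u w
      · rw [indicator_of_mem hv, indicator_of_mem (show (w, v) ∈ S from ⟨hv.1, hv.2, hw.2⟩)]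
      · rw [indicator_of_notMem hv, indicator_of_notMem]
        exact fun h => hv ⟨h.1, h.2.1⟩
    · rw [indicator_of_notMem hw]
      symm
      refine (lintegral_congr fun v => indicator_of_notMem ?_ _).trans lintegral_zero
      exact fun h => hw ⟨h.1.trans h.2.1, h.2.2⟩
  have h2 : ∫⁻ v in Ioo u t, ∫⁻ y, Q.E u x v * (∫⁻ w in Ioo v t, Q.F n v y w f) ∂(Q.qp x v)
      = ∫⁻ v, ∫⁻ w, S.indicator g (w, v) := by
    rw [← lintegral_indicator measurableSet_Ioo]
    congr with v
    by_cases hv : v ∈ Ioo u t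
    · rw [indicator_of_mem hv]
      have hm2 : Measurable fun p : X × ℝ => Q.F n v p.1 p.2 f :=
        (Q.measurable_F hf n).comp (by fun_prop : Measurable fun p : X × ℝ => (v, p.1, p.2))
      have : ∀ y, Q.E u x v * ∫⁻ w in Ioo v t, Q.F n v y w f
          = ∫⁻ w in Ioo v t, Q.E u x v * Q.F n v y w f := fun y => by
        rw [lintegral_const_mul _ (Q.measurable_F_t hf n v y)]
      simp only [this]
      rw [lintegral_lintegral_swap (hm2.const_mul _).aemeasurable]
      rw [← lintegral_indicator measurableSet_Ioo]
      congr with w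
      by_cases hw : w ∈ Ioo v t
      · rw [indicator_of_mem hw, indicator_of_mem (show (w, v) ∈ S from ⟨hv.1, hw.1, hw.2⟩)]
      · rw [indicator_of_notMem hw, indicator_of_notMem]
        exact fun h => hw ⟨h.2.1, h.2.2⟩
    · rw [indicator_of_notMem hv]
      symm
      refine (lintegral_congr fun w => indicator_of_notMem ?_ _).trans lintegral_zero
      exact fun h => hv ⟨h.1, h.2.1.trans h.2.2⟩
  rw [h1, h2]
  exact lintegral_lintegral_swap (f := fun w v => S.indicator g (w, v))
    (hgm.indicator hSm).aemeasurable

lemma exists_bound (Q : ConsQFun X T₀ T₁) (hALB : Q.AssumptionALB) (x : X) {t : ℝ}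
    (h0 : T₀ < t) (ht : (t : EReal) < T₁) :
    ∃ K : NNReal, ∀ w ∈ Icc T₀ t, Q.qrate x w ≤ K := by
  obtain ⟨t', h1, h2⟩ := EReal.lt_iff_exists_real_btwn.1 ht
  have h1' : t < t' := by exact_mod_cast h1
  have hb := hALB x t' (h0.trans h1') h2
  refine ⟨(⨆ w ∈ Set.Ico T₀ t', Q.qp x w Set.univ).toNNReal, fun w hw => ?_⟩
  exact ENNReal.toReal_mono hb.ne
    (le_iSup₂ (f := fun w (_ : w ∈ Set.Ico T₀ t') => Q.qp x w Set.univ) w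
      ⟨hw.1, hw.2.trans_lt h1'⟩)

lemma qrate_nonneg (Q : ConsQFun X T₀ T₁) (x : X) (w : ℝ) : 0 ≤ Q.qrate x w :=
  ENNReal.toReal_nonneg

lemma measurable_qrate_t (Q : ConsQFun X T₀ T₁) (x : X) : Measurable fun w => Q.qrate x w :=
  Q.measurable_qrate.comp (by fun_prop : Measurable fun w : ℝ => (x, w))

lemma base_real {q : ℝ → ℝ} {u t : ℝ} (hut : u ≤ t) (hqm : Measurable q) (K : NNReal)
    (h0 : ∀ w, 0 ≤ q w) (hK : ∀ w ∈ Icc u t, q w ≤ K) :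
    IntervalIntegrable (fun w => q w * Real.exp (-(∫ θ in u..w, q θ))) volume u t ∧
    ∫ w in u..t, q w * Real.exp (-(∫ θ in u..w, q θ)) = 1 - Real.exp (-(∫ θ in u..t, q θ)) := by
  have hqi : IntervalIntegrable q volume u t := by
    rw [intervalIntegrable_iff_integrableOn_Icc_of_le hut]
    refine Measure.integrableOn_of_bounded (M := K) (by simp) hqm.aestronglyMeasurable ?_
    filter_upwards [ae_restrict_mem measurableSet_Icc] with w hw
    rw [Real.norm_of_nonneg (h0 w)]
    exact hK w hw
  have hsub : ∀ {a b}, a ∈ Icc u t → b ∈ Icc u t → IntervalIntegrable q volume a b := by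
    intro a b ha hb
    refine hqi.mono_set ?_
    rw [uIcc_of_le hut]
    exact ordConnected_Icc.uIcc_subset ha hb
  have hI : LipschitzOnWith K (fun w => ∫ θ in u..w, q θ) (Icc u t) := by
    refine LipschitzOnWith.of_dist_le_mul fun a ha b hb => ?_
    rw [dist_eq_norm, intervalIntegral.integral_interval_sub_left
      (hsub (left_mem_Icc.2 hut) ha) (hsub (left_mem_Icc.2 hut) hb), dist_eq_norm]
    refine intervalIntegral.norm_integral_le_of_norm_le_const fun w hw => ?_
    rw [Real.norm_of_nonneg (h0 w)]
    exact hK w (ordConnected_Icc.uIcc_subset hb ha (uIoc_subset_uIcc hw))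
  have hE : LipschitzOnWith 1 (fun a : ℝ => Real.exp (-a)) (Ici 0) := by
    refine (convex_Ici 0).lipschitzOnWith_of_nnnorm_deriv_le (𝕜 := ℝ)
      (fun a _ => by fun_prop) (fun a ha => ?_)
    have : deriv (fun a : ℝ => Real.exp (-a)) a = -Real.exp (-a) := by
      have := ((hasDerivAt_id a).neg.exp).deriv
      simpa using this
    rw [this, ← NNReal.coe_le_coe]
    simp only [nnnorm_neg, coe_nnnorm, Real.norm_eq_abs, Real.abs_exp, NNReal.coe_one,
      Real.exp_le_one_iff]
    simpa using ha
  have hL : LipschitzOnWith (1 * K) (fun w => Real.exp (-(∫ θ in u..w, q θ))) (Icc u t) :=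
    hE.comp hI fun w hw => intervalIntegral.integral_nonneg hw.1 fun θ _ => h0 θ
  have hii : IntervalIntegrable (fun w => q w * Real.exp (-(∫ θ in u..w, q θ))) volume u t :=
    hqi.mul_continuousOn (by rw [uIcc_of_le hut]; exact hL.continuousOn)
  refine ⟨hii, ?_⟩
  have hac : AbsolutelyContinuousOnInterval (fun w => Real.exp (-(∫ θ in u..w, q θ))) u t :=
    LipschitzOnWith.absolutelyContinuousOnInterval (K := 1 * K) (by rwa [uIcc_of_le hut])
  have hftc := hac.integral_deriv_eq_sub
  simp only [intervalIntegral.integral_same, neg_zero, Real.exp_zero] at hftc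
  have : ∫ w in u..t, deriv (fun w => Real.exp (-(∫ θ in u..w, q θ))) w
      = ∫ w in u..t, -(q w * Real.exp (-(∫ θ in u..w, q θ))) := by
    refine intervalIntegral.integral_congr_ae ?_
    filter_upwards [hqi.ae_hasDerivAt_integral] with w hw hwm
    have h1 := hw (uIoc_subset_uIcc hwm) u left_mem_uIcc
    have h2 : HasDerivAt (fun w => Real.exp (-(∫ θ in u..w, q θ)))
        (Real.exp (-(∫ θ in u..w, q θ)) * -q w) w := h1.neg.exp
    rw [h2.deriv]
    ring
  rw [this, intervalIntegral.integral_neg] at hftc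
  linarith

lemma baseE (Q : ConsQFun X T₀ T₁) (hALB : Q.AssumptionALB) (x : X) {u t : ℝ}
    (hu : T₀ ≤ u) (hut : u < t) (ht : (t : EReal) < T₁) :
    Q.E u x t + ∫⁻ w in Ioo u t, Q.E u x w * Q.qp x w univ = 1 := by
  obtain ⟨K, hK⟩ := Q.exists_bound hALB x (hu.trans_lt hut) ht
  obtain ⟨hi, he⟩ := base_real hut.le (Q.measurable_qrate_t x) K (Q.qrate_nonneg x)
    (fun w hw => hK w ⟨hu.trans hw.1, hw.2⟩)
  rw [intervalIntegrable_iff_integrableOn_Ioo_of_le hut.le] at hi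
  rw [intervalIntegral.integral_of_le hut.le, integral_Ioc_eq_integral_Ioo] at he
  have h1 : ∀ w, Q.E u x w * Q.qp x w univ
      = ENNReal.ofReal (Q.qrate x w * Real.exp (-(∫ θ in u..w, Q.qrate x θ))) := by
    intro w
    rw [ENNReal.ofReal_mul (Q.qrate_nonneg x w), mul_comm, qrate, ENNReal.ofReal_toReal (Q.fin x w)]
    rfl
  simp only [h1]
  rw [← ofReal_integral_eq_lintegral_ofReal hi
    (Eventually.of_forall fun w => mul_nonneg (Q.qrate_nonneg x w) (Real.exp_pos _).le), he, E,
    ← ENNReal.ofReal_add (Real.exp_pos _).le]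
  · simp
  · rw [← he]
    exact integral_nonneg fun w => mul_nonneg (Q.qrate_nonneg x w) (Real.exp_pos _).le

/-- indicator test function -/
def f1 (B : Set X) : ℝ → X → ℝ≥0∞ := fun _ => B.indicator 1

/-- loss test function -/
def fL (Q : ConsQFun X T₀ T₁) (B : Set X) : ℝ → X → ℝ≥0∞ :=
  fun t => B.indicator fun y => Q.qp y t univ

/-- gain test function -/
def fG (Q : ConsQFun X T₀ T₁) (B : Set X) : ℝ → X → ℝ≥0∞ := fun t y => Q.qp y t B

lemma measurable_f1 {B : Set X} (hB : MeasurableSet B) :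
    Measurable fun p : ℝ × X => f1 B p.1 p.2 :=
  (measurable_one.indicator hB).comp measurable_snd

lemma measurable_fG (Q : ConsQFun X T₀ T₁) {B : Set X} (hB : MeasurableSet B) :
    Measurable fun p : ℝ × X => Q.fG B p.1 p.2 :=
  (Q.meas B hB).comp measurable_swap

lemma measurable_fL (Q : ConsQFun X T₀ T₁) {B : Set X} (hB : MeasurableSet B) :
    Measurable fun p : ℝ × X => Q.fL B p.1 p.2 :=
  Measurable.indicator ((Q.meas univ .univ).comp measurable_swap) (measurable_snd hB)

lemma ident_zero (Q : ConsQFun X T₀ T₁) (hALB : Q.AssumptionALB) (x : X) {u t : ℝ}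
    (hu : T₀ ≤ u) (hut : u < t) (ht : (t : EReal) < T₁) (B : Set X) :
    Q.F 0 u x t (f1 B) + ∫⁻ w in Ioo u t, Q.F 0 u x w (Q.fL B) = B.indicator 1 x := by
  by_cases h : x ∈ B
  · simpa [F, f1, fL, h] using Q.baseE hALB x hu hut ht
  · simp [F, f1, fL, h]

lemma ident_step (Q : ConsQFun X T₀ T₁) (x : X) {u t : ℝ}
    {B : Set X} (hB : MeasurableSet B) (n : ℕ) :
    Q.F (n + 1) u x t (f1 B) + ∫⁻ w in Ioo u t, Q.F (n + 1) u x w (Q.fL B) =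
      ∫⁻ v in Ioo u t, ∫⁻ y, Q.E u x v *
        (Q.F n v y t (f1 B) + ∫⁻ w in Ioo v t, Q.F n v y w (Q.fL B)) ∂(Q.qp x v) := by
  rw [Q.swap (Q.measurable_fL hB)]
  simp only [F]
  rw [← lintegral_add_left (Q.measurable_Fint (measurable_f1 hB) n u x t)]
  congr with v
  rw [← lintegral_add_left ((Q.measurable_F_y (measurable_f1 hB) n v t).const_mul _)]
  simp only [mul_add]

lemma ident_succ (Q : ConsQFun X T₀ T₁) (hALB : Q.AssumptionALB) (x : X) {u t : ℝ}
    (hu : T₀ ≤ u) (ht : (t : EReal) < T₁) {B : Set X} (hB : MeasurableSet B) (n : ℕ) :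
    Q.F (n + 1) u x t (f1 B) + ∫⁻ w in Ioo u t, Q.F (n + 1) u x w (Q.fL B) =
      ∫⁻ w in Ioo u t, Q.F n u x w (Q.fG B) := by
  induction n generalizing u x with
  | zero =>
    rw [Q.ident_step x hB]
    refine setLIntegral_congr_fun measurableSet_Ioo fun v hv => ?_
    have : ∀ y, Q.F 0 v y t (f1 B) + ∫⁻ w in Ioo v t, Q.F 0 v y w (Q.fL B) = B.indicator 1 y :=
      fun y => Q.ident_zero hALB y (hu.trans hv.1.le) hv.2 ht B
    simp only [this]
    rw [lintegral_const_mul _ (measurable_one.indicator hB), lintegral_indicator_one hB]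
    rfl
  | succ n ih =>
    rw [Q.ident_step x hB, Q.swap (Q.measurable_fG hB)]
    refine setLIntegral_congr_fun measurableSet_Ioo fun v hv => ?_
    refine lintegral_congr fun y => ?_
    rw [ih y (hu.trans hv.1.le)]

lemma ident_sum (Q : ConsQFun X T₀ T₁) (hALB : Q.AssumptionALB) (x : X) {u t : ℝ}
    (hu : T₀ ≤ u) (hut : u < t) (ht : (t : EReal) < T₁) {B : Set X} (hB : MeasurableSet B) :
    Q.Pbar u x t B + ∫⁻ w in Ioo u t, ∑' n, Q.F n u x w (Q.fL B) =
      B.indicator 1 x + ∫⁻ w in Ioo u t, ∑' n, Q.F n u x w (Q.fG B) := by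
  rw [lintegral_tsum (fun n => (Q.measurable_F_t (Q.measurable_fL hB) n u x).aemeasurable),
    lintegral_tsum (fun n => (Q.measurable_F_t (Q.measurable_fG hB) n u x).aemeasurable), Pbar,
    ← ENNReal.tsum_add, tsum_eq_zero_add' ENNReal.summable]
  simp only [PbarN_eq_F]
  congr 1
  · exact Q.ident_zero hALB x hu hut ht B
  · congr with n
    exact Q.ident_succ hALB x hu ht hB n

lemma Pbar_le_one (Q : ConsQFun X T₀ T₁) (hALB : Q.AssumptionALB) (x : X) {u t : ℝ}
    (hu : T₀ ≤ u) (hut : u < t) (ht : (t : EReal) < T₁) (B : Set X) :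
    Q.Pbar u x t B ≤ 1 := by
  have hone : Measurable fun p : ℝ × X => f1 (univ : Set X) p.1 p.2 := measurable_f1 .univ
  have key : ∀ N u x, T₀ ≤ u → u < t →
      ∑ n ∈ Finset.range N, Q.F n u x t (f1 univ) ≤ 1 := by
    intro N
    induction N with
    | zero => simp
    | succ N ih =>
      intro u x hu hut
      rw [Finset.sum_range_succ']
      rw [← Q.baseE hALB x hu hut ht, add_comm]
      refine add_le_add (by simp [F, f1]) ?_
      simp only [F]
      rw [← lintegral_finsetSum _ (fun n _ => Q.measurable_Fint hone n u x t)]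
      refine setLIntegral_mono' measurableSet_Ioo fun v hv => ?_
      rw [← lintegral_finsetSum _ (fun n _ => (Q.measurable_F_y hone n v t).const_mul _),
        ← lintegral_const]
      refine lintegral_mono fun y => ?_
      rw [← Finset.mul_sum]
      calc _ ≤ Q.E u x v * 1 := mul_le_mul_right (ih v y (hu.trans hv.1.le) hv.2) _
        _ = _ := mul_one _
  rw [Pbar, ENNReal.tsum_eq_iSup_nat]
  refine iSup_le fun N => le_trans (Finset.sum_le_sum fun n _ => ?_) (key N u x hu hut)
  rw [PbarN_eq_F]
  refine Q.F_mono n u x t fun y => ?_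
  exact indicator_le_indicator_of_subset (subset_univ _) (fun _ => zero_le) y

end ConsQFun

lemma absCont_of_interval {f : ℝ → ℝ} {a b : ℝ} (hab : a ≤ b)
    (h : AbsolutelyContinuousOnInterval f a b) : AbsContinuousOn f (Ioo a b) := by
  rw [absolutelyContinuousOnInterval_iff] at h
  intro ε hε
  obtain ⟨δ, hδ, H⟩ := h ε hε
  refine ⟨δ, hδ, fun n c d hcd hdis hlen => ?_⟩
  have := H (n, fun i => (c i, d i)) ⟨?_, ?_⟩ ?_
  · simpa [Real.dist_eq, abs_sub_comm] using this
  · intro i hi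
    obtain ⟨h1, h2, -⟩ := hcd i (Finset.mem_range.1 hi)
    rw [uIcc_of_le hab]
    exact ⟨Ioo_subset_Icc_self h1, Ioo_subset_Icc_self h2⟩
  · intro i hi j hj hij
    have hi' : i < n := by simpa using hi
    have hj' : j < n := by simpa using hj
    have := hdis i hi' j hj' hij
    rw [Ioo_disjoint_Ioo] at this
    simp only [Function.onFun]
    rw [uIoc_of_le (hcd i hi').2.2, uIoc_of_le (hcd j hj').2.2, Ioc_disjoint_Ioc]
    exact this
  · refine lt_of_eq_of_lt (Finset.sum_congr rfl fun i hi => ?_) hlen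
    rw [dist_comm, Real.dist_eq, abs_of_nonneg]
    linarith [(hcd i (Finset.mem_range.1 hi)).2.2]

lemma AbsContinuousOn.congr' {f g : ℝ → ℝ} {s : Set ℝ} (h : AbsContinuousOn f s)
    (hfg : ∀ t ∈ s, g t = f t) : AbsContinuousOn g s := by
  intro ε hε
  obtain ⟨δ, hδ, H⟩ := h ε hε
  refine ⟨δ, hδ, fun n c d hcd hdis hlen => ?_⟩
  refine lt_of_eq_of_lt (Finset.sum_congr rfl fun i hi => ?_) (H n c d hcd hdis hlen)
  obtain ⟨h1, h2, -⟩ := hcd i (Finset.mem_range.1 hi)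
  rw [hfg _ h1, hfg _ h2]

/-- under Assumption ALB, for all `u ∈ [T₀,T₁)`, `s ∈ (u,T₁)`, `x ∈ X`
and every `(q,s)`-bounded Borel set `B`: `P̄(u,x;t,B) → 1{x∈B}` as `t → u+`,
`t ↦ P̄(u,x;t,B)` is absolutely continuous on `(u,s)`, and Kolmogorov's forward equation
`(∂/∂t)P̄(u,x;t,B) = −∫_B q(y,t) P̄(u,x;t,dy) + ∫_X q(y,t,B∖{y}) P̄(u,x;t,dy)`
holds for almost every `t ∈ (u,s)` (integration with respect to `P̄(u,x;t,dy)` being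
expressed via any measure `μ t` agreeing with `P̄(u,x;t,·)` on Borel sets). -/
theorem pbar_satisfies_forward_equation
    {X : Type*} [MeasurableSpace X] [StandardBorelSpace X]
    {T₀ : ℝ} {T₁ : EReal} (hT : (T₀ : EReal) < T₁)
    (Q : ConsQFun X T₀ T₁) (hALB : Q.AssumptionALB)
    (u s : ℝ) (x : X) (B : Set X)
    (hu : T₀ ≤ u) (hus : u < s) (hs : (s : EReal) < T₁)
    (hB : MeasurableSet B) (hqB : Q.QBddOn (s : EReal) B) :
    Filter.Tendsto (fun t => Q.PbarR u x t B) (𝓝[>] u)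
      (𝓝 (B.indicator (fun _ => (1 : ℝ)) x)) ∧
    AbsContinuousOn (fun t => Q.PbarR u x t B) (Set.Ioo u s) ∧
    ∀ μ : ℝ → Measure X,
      (∀ t : ℝ, u < t → (t : EReal) < T₁ → ∀ C : Set X, MeasurableSet C →
        μ t C = Q.Pbar u x t C) →
      ∀ᵐ t ∂(volume.restrict (Set.Ioo u s)),
        HasDerivAt (fun r => Q.PbarR u x r B)
          (-(∫ y in B, Q.qrate y t ∂(μ t)) + ∫ y, (Q.qp y t B).toReal ∂(μ t)) t := by
  classical
  set L : ℝ → ℝ≥0∞ := fun w => ∑' n, Q.F n u x w (Q.fL B) with hL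
  set G : ℝ → ℝ≥0∞ := fun w => ∑' n, Q.F n u x w (Q.fG B) with hG
  have hLm : Measurable L :=
    Measurable.tsum fun n => Q.measurable_F_t (Q.measurable_fL hB) n u x
  have hGm : Measurable G :=
    Measurable.tsum fun n => Q.measurable_F_t (Q.measurable_fG hB) n u x
  have hltT : ∀ t, t ≤ s → (t : EReal) < T₁ := fun t ht =>
    lt_of_le_of_lt (by exact_mod_cast ht) hs
  obtain ⟨C, hC, hCb⟩ := hqB
  have hLC : ∀ w ∈ Ioo u s, L w ≤ C := by
    intro w hw
    calc L w ≤ ∑' n, C * Q.PbarN n u x w B := by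
          refine ENNReal.tsum_le_tsum fun n => ?_
          rw [ConsQFun.PbarN_eq_F]
          change _ ≤ C * Q.F n u x w (ConsQFun.f1 B)
          rw [← Q.F_smul (ConsQFun.measurable_f1 hB)]
          refine Q.F_mono n u x w fun y => ?_
          by_cases hy : y ∈ B
          · simpa [ConsQFun.fL, ConsQFun.f1, hy] using
              hCb y hy w (hu.trans hw.1.le) (by exact_mod_cast hw.2)
          · simp [ConsQFun.fL, hy]
      _ = C * Q.Pbar u x w B := ENNReal.tsum_mul_left
      _ ≤ C * 1 := mul_le_mul_right (Q.Pbar_le_one hALB x hu hw.1 (hltT w hw.2.le) B) _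
      _ = C := mul_one _
  have hLfin : ∫⁻ w in Ioo u s, L w ≠ ⊤ := by
    have : ∫⁻ w in Ioo u s, L w ≤ ∫⁻ _ in Ioo u s, C :=
      setLIntegral_mono' measurableSet_Ioo hLC
    refine ne_top_of_le_ne_top ?_ this
    rw [setLIntegral_const, Real.volume_Ioo]
    finiteness
  have hGfin : ∫⁻ w in Ioo u s, G w ≠ ⊤ := by
    have h1 := Q.ident_sum hALB x hu hus hs hB
    refine ne_top_of_le_ne_top (b := 1 + ∫⁻ w in Ioo u s, L w) (by finiteness) ?_
    calc ∫⁻ w in Ioo u s, G w ≤ B.indicator 1 x + ∫⁻ w in Ioo u s, G w := le_add_self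
      _ = Q.Pbar u x s B + ∫⁻ w in Ioo u s, L w := h1.symm
      _ ≤ _ := by gcongr; exact Q.Pbar_le_one hALB x hu hus hs B
  have hLi : IntegrableOn (fun w => (L w).toReal) (Ioo u s) :=
    integrable_toReal_of_lintegral_ne_top hLm.aemeasurable hLfin
  have hGi : IntegrableOn (fun w => (G w).toReal) (Ioo u s) :=
    integrable_toReal_of_lintegral_ne_top hGm.aemeasurable hGfin
  set g : ℝ → ℝ := fun w => -(L w).toReal + (G w).toReal with hg
  have hgi : IntervalIntegrable g volume u s := by
    rw [intervalIntegrable_iff_integrableOn_Ioo_of_le hus.le]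
    exact hLi.neg.add hGi
  set c : ℝ := B.indicator (fun _ => (1 : ℝ)) x with hc
  have hrep : ∀ t ∈ Ioo u s, Q.PbarR u x t B = c + ∫ w in u..t, g w := by
    intro t ht
    have hsub : Ioo u t ⊆ Ioo u s := Ioo_subset_Ioo_right ht.2.le
    have hLt : ∫⁻ w in Ioo u t, L w ≠ ⊤ := ne_top_of_le_ne_top hLfin (lintegral_mono_set hsub)
    have hGt : ∫⁻ w in Ioo u t, G w ≠ ⊤ := ne_top_of_le_ne_top hGfin (lintegral_mono_set hsub)
    have hP := Q.Pbar_le_one hALB x hu ht.1 (hltT t ht.2.le) B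
    have hP' : Q.Pbar u x t B ≠ ⊤ := ne_top_of_le_ne_top ENNReal.one_ne_top hP
    have h1 := congrArg ENNReal.toReal (Q.ident_sum hALB x hu ht.1 (hltT t ht.2.le) hB)
    have hc1 : (B.indicator 1 x : ℝ≥0∞).toReal = c := by
      by_cases h : x ∈ B <;> simp [hc, h]
    have hc2 : (B.indicator 1 x : ℝ≥0∞) ≠ ⊤ := by
      by_cases h : x ∈ B <;> simp [h]
    rw [ENNReal.toReal_add hP' hLt, ENNReal.toReal_add hc2 hGt, hc1,
      ← integral_toReal hLm.aemeasurable (ae_lt_top hLm hLt),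
      ← integral_toReal hGm.aemeasurable (ae_lt_top hGm hGt)] at h1
    rw [intervalIntegral.integral_of_le ht.1.le, integral_Ioc_eq_integral_Ioo, hg]
    have h2 : ∫ w in Ioo u t, (-(L w).toReal + (G w).toReal)
        = -(∫ w in Ioo u t, (L w).toReal) + ∫ w in Ioo u t, (G w).toReal := by
      rw [← integral_neg]
      exact integral_add (hLi.mono_set hsub).neg (hGi.mono_set hsub)
    rw [h2, ConsQFun.PbarR]
    linarith
  refine ⟨?_, ?_, ?_⟩
  · have hcont : ContinuousOn (fun t => c + ∫ w in u..t, g w) (Icc u s) := by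
      have := intervalIntegral.continuousOn_primitive_interval
        (μ := volume) (f := g) (a := u) (b := s) ?_
      · rw [uIcc_of_le hus.le] at this
        exact continuousOn_const.add this
      · rw [uIcc_of_le hus.le, ← intervalIntegrable_iff_integrableOn_Icc_of_le hus.le]
        exact hgi
    have h1 := (hcont u (left_mem_Icc.2 hus.le)).tendsto
    simp only [intervalIntegral.integral_same, add_zero] at h1
    have h2 : Tendsto (fun t => c + ∫ w in u..t, g w) (𝓝[Ioo u s] u) (𝓝 c) :=
      h1.mono_left (nhdsWithin_mono _ Ioo_subset_Icc_self)
    rw [nhdsWithin_Ioo_eq_nhdsGT hus] at h2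
    refine h2.congr' ?_
    filter_upwards [Ioo_mem_nhdsGT hus] with t ht using (hrep t ht).symm
  · have hac : AbsolutelyContinuousOnInterval (fun t => ∫ w in u..t, g w) u s :=
      hgi.absolutelyContinuousOnInterval_intervalIntegral left_mem_uIcc
    have hcst : AbsolutelyContinuousOnInterval (fun _ : ℝ => c) u s :=
      LipschitzOnWith.absolutelyContinuousOnInterval (K := 0)
        (LipschitzWith.const c).lipschitzOnWith
    exact (absCont_of_interval hus.le (hcst.add hac)).congr' hrep
  · intro μ hμ
    rw [ae_restrict_iff' measurableSet_Ioo]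
    filter_upwards [hgi.ae_hasDerivAt_integral] with t hder ht
    have hd := (hder (by rw [uIcc_of_le hus.le]; exact Ioo_subset_Icc_self ht) u
      left_mem_uIcc).const_add c
    have hqt : ∀ D : Set X, MeasurableSet D → Measurable fun y => Q.qp y t D := fun D hD =>
      (Q.meas D hD).comp (by fun_prop : Measurable fun y : X => (y, t))
    have hμt := hμ t ht.1 (hltT t ht.2.le)
    have hFcongr : ∀ (f : ℝ → X → ℝ≥0∞) n, Q.F n u x t (fun _ => f t) = Q.F n u x t f :=
      fun f n => le_antisymm (Q.F_mono n u x t fun _ => le_rfl) (Q.F_mono n u x t fun _ => le_rfl)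
    have e1 : ∫ y in B, Q.qrate y t ∂(μ t) = (L t).toReal := by
      simp only [ConsQFun.qrate]
      rw [integral_toReal (hqt univ .univ).aemeasurable
        (Eventually.of_forall fun y => lt_top_iff_ne_top.2 (Q.fin y t)),
        ← lintegral_indicator hB,
        Q.lintegral_of_agree u x t (μ t) hμt ((hqt univ .univ).indicator hB)]
      congr 1
      exact tsum_congr fun n => hFcongr (Q.fL B) n
    have e2 : ∫ y, (Q.qp y t B).toReal ∂(μ t) = (G t).toReal := by
      rw [integral_toReal (hqt B hB).aemeasurable
        (Eventually.of_forall fun y => measure_lt_top _ _),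
        Q.lintegral_of_agree u x t (μ t) hμt (hqt B hB)]
      congr 1
      exact tsum_congr fun n => hFcongr (Q.fG B) n
    rw [e1, e2]
    refine hd.congr_of_eventuallyEq ?_
    filter_upwards [Ioo_mem_nhds ht.1 ht.2] with r hr using hrep r hr
end
end
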